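/- Let b ≥ δ > 0 and d, r, n positive integers with bd < 1. Let θ ∈ [−b,b]ⁿ and M an n×n symmetric matrix with M_{i,i} = 0 for all i, |M_{i,j}| ≤ b for all i, j, each row of M having at most d nonzero entries, and such that every cycle in the weighted graph G with adjacency matrix M has length greater than r. Let v ≠ u be vertices of G such that there is a path of length r' between them for some r' < r/2 in which every edge has weight of absolute value at least δ. Let X ∼ I_{(M,θ)}. Then |P[X_v = 1 | X_u = 1] − P[X_v = 1 | X_u = −1]| ≥ e^{−4r'}·tanh^{r'}(δ) − 2(bd)^{r/2}/(1 − bd). -/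

import Mathlib

open Finset Real
open scoped Classical

noncomputable section

/-- The real spin value (`±1`) of a Boolean configuration entry. -/
def spin (s : Bool) : ℝ := if s then 1 else -1

/-- The unnormalized Ising weight `exp(θ·x + ½ x·Mx)` of a configuration. -/
def isingWt {n : ℕ} (M : Matrix (Fin n) (Fin n) ℝ) (θ : Fin n → ℝ) (σ : Fin n → Bool) : ℝ :=
  Real.exp ((∑ i, θ i * spin (σ i)) + (1 / 2) * ∑ i, ∑ j, spin (σ i) * M i j * spin (σ j))

/-- The Ising probability of a single configuration. -/
def isingProb {n : ℕ} (M : Matrix (Fin n) (Fin n) ℝ) (θ : Fin n → ℝ) (σ : Fin n → Bool) : ℝ :=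
  isingWt M θ σ / ∑ τ : Fin n → Bool, isingWt M θ τ

/-- The Ising probability of an event `A`. -/
def isingPr {n : ℕ} (M : Matrix (Fin n) (Fin n) ℝ) (θ : Fin n → ℝ)
    (A : (Fin n → Bool) → Prop) : ℝ :=
  ∑ σ ∈ Finset.univ.filter (fun σ => A σ), isingProb M θ σ

/-- The Ising conditional probability `P[A | B]`. -/
def isingCond {n : ℕ} (M : Matrix (Fin n) (Fin n) ℝ) (θ : Fin n → ℝ)
    (A B : (Fin n → Bool) → Prop) : ℝ :=
  isingPr M θ (fun σ => A σ ∧ B σ) / isingPr M θ B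

/-- There is a path of length exactly `r'` from `v` to `u` in the weighted graph with adjacency
matrix `M`, all of whose edges have weight of absolute value at least `δ`. -/
def heavyPathOfLength {n : ℕ} (M : Matrix (Fin n) (Fin n) ℝ) (δ : ℝ) (r' : ℕ)
    (v u : Fin n) : Prop :=
  ∃ p : ℕ → Fin n, p 0 = v ∧ p r' = u ∧
    (∀ i < r', M (p i) (p (i + 1)) ≠ 0 ∧ δ ≤ |M (p i) (p (i + 1))|) ∧
    (∀ i ≤ r', ∀ j ≤ r', p i = p j → i = j)

/-- Every cycle of the weighted graph with adjacency matrix `M` has length greater than `r`. -/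
def girthGT {n : ℕ} (M : Matrix (Fin n) (Fin n) ℝ) (r : ℕ) : Prop :=
  ∀ (k : ℕ) (p : ℕ → Fin n), 2 < k → p k = p 0 →
    (∀ i < k, M (p i) (p (i + 1)) ≠ 0) →
    (∀ i < k, ∀ j < k, p i = p j → i = j) → r < k

/-- The interaction matrix obtained by deleting all the edges at the vertex `v`. -/
def isolate {n : ℕ} (M : Matrix (Fin n) (Fin n) ℝ) (v : Fin n) : Matrix (Fin n) (Fin n) ℝ :=
  fun i j => if i = v ∨ j = v then 0 else M i j

/-- The total weight of the configurations in the event `A`. -/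
def eventWt {n : ℕ} (M : Matrix (Fin n) (Fin n) ℝ) (θ : Fin n → ℝ)
    (A : (Fin n → Bool) → Prop) : ℝ :=
  ∑ σ ∈ Finset.univ.filter (fun σ => A σ), isingWt M θ σ

/-- The influence of the spin at `v` on the spin at `u`. -/
def influence {n : ℕ} (M : Matrix (Fin n) (Fin n) ℝ) (θ : Fin n → ℝ) (v u : Fin n) : ℝ :=
  isingCond M θ (fun σ => σ u = true) (fun σ => σ v = true) -
    isingCond M θ (fun σ => σ u = true) (fun σ => σ v = false)

/-- The variation of the probability of `+` when the field on a spin changes from `-a` to `a`,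
the weights of the two values at zero field being `A` and `B`. -/
def fieldResponse (A B a : ℝ) : ℝ :=
  Real.exp a * A / (Real.exp a * A + Real.exp (-a) * B) -
    Real.exp (-a) * A / (Real.exp (-a) * A + Real.exp a * B)

/-- The interaction is symmetric, has zero diagonal, entries bounded by `b` and at most `d` nonzero
entries in each row. -/
structure SparseInteraction {n : ℕ} (M : Matrix (Fin n) (Fin n) ℝ) (b : ℝ) (d : ℕ) : Prop where
  symm : ∀ i j, M i j = M j i
  diag : ∀ i, M i i = 0
  bound : ∀ i j, |M i j| ≤ b
  sparse : ∀ i, (Finset.univ.filter (fun j => M i j ≠ 0)).card ≤ d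

/-- `p` restricted to `[0, k]` is a path from `v` to `u`. -/
structure IsPathOn {n : ℕ} (M : Matrix (Fin n) (Fin n) ℝ) (p : ℕ → Fin n) (k : ℕ)
    (v u : Fin n) : Prop where
  source : p 0 = v
  target : p k = u
  adj : ∀ i < k, M (p i) (p (i + 1)) ≠ 0
  inj : ∀ i ≤ k, ∀ j ≤ k, p i = p j → i = j

section Weights

variable {n : ℕ} (M : Matrix (Fin n) (Fin n) ℝ) (θ : Fin n → ℝ)

theorem isingWt_pos (σ : Fin n → Bool) : 0 < isingWt M θ σ := Real.exp_pos _

theorem spin_not (s : Bool) : spin (!s) = -spin s := by cases s <;> simp [spin]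

theorem abs_spin (s : Bool) : |spin s| = 1 := by cases s <;> simp [spin]

theorem eventWt_nonneg (A : (Fin n → Bool) → Prop) : 0 ≤ eventWt M θ A :=
  Finset.sum_nonneg fun σ _ => (isingWt_pos M θ σ).le

theorem eventWt_pos {A : (Fin n → Bool) → Prop} (hA : ∃ σ, A σ) : 0 < eventWt M θ A := by
  obtain ⟨σ, hσ⟩ := hA
  exact Finset.sum_pos (fun σ _ => isingWt_pos M θ σ) ⟨σ, by simpa using hσ⟩

theorem eventWt_spin_pos (w : Fin n) (s : Bool) : 0 < eventWt M θ (fun σ => σ w = s) :=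
  eventWt_pos M θ ⟨fun _ => s, rfl⟩

theorem eventWt_mono {A B : (Fin n → Bool) → Prop} (h : ∀ σ, A σ → B σ) :
    eventWt M θ A ≤ eventWt M θ B := by
  refine Finset.sum_le_sum_of_subset_of_nonneg ?_ fun σ _ _ => (isingWt_pos M θ σ).le
  intro σ
  simpa using h σ

theorem isingPr_eq (A : (Fin n → Bool) → Prop) :
    isingPr M θ A = eventWt M θ A / eventWt M θ (fun _ => True) := by
  simp [isingPr, eventWt, isingProb, Finset.sum_div]

theorem isingCond_eq (A B : (Fin n → Bool) → Prop) :
    isingCond M θ A B = eventWt M θ (fun σ => A σ ∧ B σ) / eventWt M θ B := by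
  have h : eventWt M θ (fun _ => True) ≠ 0 := (eventWt_pos M θ ⟨fun _ => true, trivial⟩).ne'
  rw [isingCond, isingPr_eq, isingPr_eq, div_div_div_cancel_right₀ h]

theorem eventWt_split (A : (Fin n → Bool) → Prop) (w : Fin n) :
    eventWt M θ A =
      eventWt M θ (fun σ => A σ ∧ σ w = true) + eventWt M θ (fun σ => A σ ∧ σ w = false) := by
  unfold eventWt
  rw [← Finset.sum_filter_add_sum_filter_not _ (fun σ => σ w = true), Finset.filter_filter,
    Finset.filter_filter]
  simp

theorem eventWt_flip_le (c : ℝ) (w : Fin n) (A B : (Fin n → Bool) → Prop)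
    (hAB : ∀ σ, A σ → B (Function.update σ w (!σ w)))
    (h : ∀ σ, A σ → isingWt M θ σ ≤ c * isingWt M θ (Function.update σ w (!σ w)))
    (hc : 0 ≤ c) :
    eventWt M θ A ≤ c * eventWt M θ B := by
  unfold eventWt
  rw [Finset.mul_sum]
  have hinj : Function.Injective (fun σ : Fin n → Bool => Function.update σ w (!σ w)) := by
    apply Function.Involutive.injective
    intro σ
    simp
  calc _ ≤ ∑ σ ∈ Finset.univ.filter (fun σ => A σ),
        c * isingWt M θ (Function.update σ w (!σ w)) :=
        Finset.sum_le_sum fun σ hσ => h σ (by simpa using hσ)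
    _ = ∑ τ ∈ (Finset.univ.filter (fun σ => A σ)).image
          (fun σ : Fin n → Bool => Function.update σ w (!σ w)), c * isingWt M θ τ := by
        rw [Finset.sum_image fun x _ y _ hxy => hinj hxy]
    _ ≤ _ := by
        refine Finset.sum_le_sum_of_subset_of_nonneg ?_ fun σ _ _ =>
          mul_nonneg hc (isingWt_pos M θ σ).le
        intro τ
        simp only [Finset.mem_image, Finset.mem_filter, Finset.mem_univ, true_and]
        rintro ⟨σ, hσ, rfl⟩
        exact hAB σ hσ

theorem isingWt_flip (hsymm : ∀ i j, M i j = M j i) (hdiag : ∀ i, M i i = 0)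
    (σ : Fin n → Bool) (w : Fin n) :
    isingWt M θ σ = Real.exp (2 * (spin (σ w) * (θ w + ∑ j, M w j * spin (σ j)))) *
      isingWt M θ (Function.update σ w (!σ w)) := by
  unfold isingWt
  rw [← Real.exp_add]
  congr 1
  have hx : ∀ i, spin (Function.update σ w (!σ w) i) =
      spin (σ i) + if i = w then -2 * spin (σ w) else 0 := by
    intro i
    by_cases h : i = w
    · subst h
      simp [spin_not]
      ring
    · simp [h]
  simp only [hx, add_mul, mul_add, Finset.sum_add_distrib, ite_mul, mul_ite, mul_zero, zero_mul,
    Finset.sum_ite_eq', Finset.mem_univ, if_true, Finset.sum_ite_irrel, Finset.sum_const_zero,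
    hdiag]
  have h1 : ∑ i, spin (σ i) * M i w * (-2 * spin (σ w)) =
      -2 * (spin (σ w) * ∑ j, M w j * spin (σ j)) := by
    rw [Finset.mul_sum, Finset.mul_sum]
    exact Finset.sum_congr rfl fun i _ => by rw [hsymm i w]; ring
  have h2 : ∑ j, -2 * spin (σ w) * M w j * spin (σ j) =
      -2 * (spin (σ w) * ∑ j, M w j * spin (σ j)) := by
    rw [Finset.mul_sum, Finset.mul_sum]
    exact Finset.sum_congr rfl fun i _ => by ring
  rw [h1, h2]
  ring

theorem isingWt_isolate (hsymm : ∀ i j, M i j = M j i) (hdiag : ∀ i, M i i = 0)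
    (σ : Fin n → Bool) (v : Fin n) :
    isingWt M θ σ = isingWt (isolate M v) (fun i => θ i + spin (σ v) * M v i) σ := by
  unfold isingWt
  congr 1
  have hM : ∀ i j, M i j = isolate M v i j + (if i = v then M v j else 0) +
      (if j = v then M v i else 0) := by
    intro i j
    by_cases hi : i = v <;> by_cases hj : j = v <;> simp [isolate, hi, hj, hdiag, hsymm _ v]
  have hq : ∑ i, ∑ j, spin (σ i) * M i j * spin (σ j) =
      (∑ i, ∑ j, spin (σ i) * isolate M v i j * spin (σ j)) +
        2 * ∑ j, spin (σ v) * M v j * spin (σ j) := by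
    have h1 : ∀ i j, spin (σ i) * M i j * spin (σ j) =
        spin (σ i) * isolate M v i j * spin (σ j) +
        (if i = v then spin (σ v) * M v j * spin (σ j) else 0) +
        (if j = v then spin (σ v) * M v i * spin (σ i) else 0) := by
      intro i j
      rw [hM i j]
      by_cases hi : i = v <;> by_cases hj : j = v <;> simp [hi, hj] <;> ring
    rw [Finset.sum_congr rfl fun i _ => Finset.sum_congr rfl fun j _ => h1 i j]
    simp only [Finset.sum_add_distrib, Finset.sum_ite_eq', Finset.mem_univ, if_true,
      Finset.sum_ite_irrel, Finset.sum_const_zero]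
    ring
  rw [hq]
  simp only [add_mul, Finset.sum_add_distrib]
  ring

theorem isingWt_add_single (a : ℝ) (w : Fin n) (σ : Fin n → Bool) :
    isingWt M (θ + Pi.single w a) σ = Real.exp (a * spin (σ w)) * isingWt M θ σ := by
  unfold isingWt
  rw [← Real.exp_add]
  congr 1
  simp only [Pi.add_apply, add_mul, Finset.sum_add_distrib, Pi.single_apply, ite_mul, zero_mul,
    Finset.sum_ite_eq', Finset.mem_univ, if_true]
  ring

end Weights

section Response

theorem fieldResponse_eq {A B : ℝ} (a : ℝ) (hA : 0 < A) (hB : 0 < B) :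
    fieldResponse A B a = A * B * ((Real.exp a + Real.exp (-a)) * (Real.exp a - Real.exp (-a))) /
      (A ^ 2 + B ^ 2 + A * B * (Real.exp a ^ 2 + Real.exp (-a) ^ 2)) := by
  have h1 : Real.exp a * Real.exp (-a) = 1 := by rw [← Real.exp_add]; simp
  have hx := Real.exp_pos a
  have hy := Real.exp_pos (-a)
  unfold fieldResponse
  generalize Real.exp a = x at *
  generalize Real.exp (-a) = y at *
  rw [div_sub_div _ _ (by positivity) (by positivity)]
  congr 1
  · ring
  · linear_combination (A ^ 2 + B ^ 2) * h1

theorem fieldResponse_zero (A B : ℝ) : fieldResponse A B 0 = 0 := by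
  simp [fieldResponse]

theorem abs_tanh_eq (a : ℝ) :
    |Real.tanh a| = |Real.exp a - Real.exp (-a)| / (Real.exp a + Real.exp (-a)) := by
  rw [Real.tanh_eq, abs_div, abs_of_pos (by positivity : 0 < Real.exp a + Real.exp (-a))]

theorem abs_fieldResponse_le {A B : ℝ} (a : ℝ) (hA : 0 < A) (hB : 0 < B) :
    |fieldResponse A B a| ≤ |Real.tanh a| := by
  have h1 : Real.exp a * Real.exp (-a) = 1 := by rw [← Real.exp_add]; simp
  have hx := Real.exp_pos a
  have hy := Real.exp_pos (-a)
  rw [fieldResponse_eq a hA hB, abs_tanh_eq, abs_div, abs_mul (A * B),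
    abs_mul (Real.exp a + _),
    abs_of_pos (mul_pos hA hB), abs_of_pos (add_pos hx hy)]
  generalize Real.exp a = x at *
  generalize Real.exp (-a) = y at *
  have hD : 0 < A ^ 2 + B ^ 2 + A * B * (x ^ 2 + y ^ 2) := by positivity
  rw [abs_of_pos hD, div_le_div_iff₀ hD (by positivity)]
  have : A * B * (x + y) ^ 2 ≤ A ^ 2 + B ^ 2 + A * B * (x ^ 2 + y ^ 2) := by
    have : A * B * (x + y) ^ 2 = A * B * (x ^ 2 + y ^ 2) + 2 * A * B := by
      linear_combination 2 * A * B * h1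
    nlinarith [sq_nonneg (A - B)]
  calc _ = |x - y| * (A * B * (x + y) ^ 2) := by ring
    _ ≤ _ := mul_le_mul_of_nonneg_left this (abs_nonneg _)

theorem le_abs_fieldResponse {A B K : ℝ} (a : ℝ) (hA : 0 < A) (hB : 0 < B) (hK : 1 ≤ K)
    (hAB : A ≤ K * B) (hBA : B ≤ K * A) :
    K⁻¹ * |Real.tanh a| ≤ |fieldResponse A B a| := by
  have h1 : Real.exp a * Real.exp (-a) = 1 := by rw [← Real.exp_add]; simp
  have hx := Real.exp_pos a
  have hy := Real.exp_pos (-a)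
  have hK0 : 0 < K := by linarith
  rw [fieldResponse_eq a hA hB, abs_tanh_eq, abs_div, abs_mul (A * B),
    abs_mul (Real.exp a + _),
    abs_of_pos (mul_pos hA hB), abs_of_pos (add_pos hx hy), inv_mul_eq_div, div_div]
  generalize Real.exp a = x at *
  generalize Real.exp (-a) = y at *
  have hD : 0 < A ^ 2 + B ^ 2 + A * B * (x ^ 2 + y ^ 2) := by positivity
  rw [abs_of_pos hD, div_le_div_iff₀ (by positivity) hD]
  have : A ^ 2 + B ^ 2 + A * B * (x ^ 2 + y ^ 2) ≤ K * (A * B * (x + y) ^ 2) := by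
    have e : A * B * (x + y) ^ 2 = A * B * (x ^ 2 + y ^ 2) + 2 * (A * B) := by
      linear_combination 2 * A * B * h1
    have hp : 0 ≤ A * B * (x ^ 2 + y ^ 2) := by positivity
    nlinarith [mul_le_mul_of_nonneg_left hAB hA.le, mul_le_mul_of_nonneg_left hBA hB.le,
      mul_le_mul_of_nonneg_right hK hp]
  calc _ ≤ |x - y| * (K * (A * B * (x + y) ^ 2)) :=
        mul_le_mul_of_nonneg_left this (abs_nonneg _)
    _ = _ := by ring

theorem tanh_monotone : Monotone Real.tanh := by
  intro x y h
  rw [Real.tanh_eq_sinh_div_cosh, Real.tanh_eq_sinh_div_cosh,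
    div_le_div_iff₀ (Real.cosh_pos _) (Real.cosh_pos _)]
  have : 0 ≤ Real.sinh (y - x) := Real.sinh_nonneg_iff.2 (sub_nonneg.2 h)
  rw [Real.sinh_sub] at this
  linarith

theorem abs_tanh (a : ℝ) : |Real.tanh a| = Real.tanh |a| := by
  rcases le_total 0 a with h | h
  · rw [abs_of_nonneg h, abs_of_nonneg (by simpa using tanh_monotone h)]
  · rw [abs_of_nonpos h, Real.tanh_neg, abs_of_nonpos (by simpa using tanh_monotone h)]

theorem tanh_le_self {a : ℝ} (ha : 0 ≤ a) : Real.tanh a ≤ a := by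
  have hmono : MonotoneOn (fun x => x * Real.cosh x - Real.sinh x) (Set.Ici 0) := by
    apply monotoneOn_of_deriv_nonneg (convex_Ici 0) (by fun_prop) (by fun_prop)
    intro x hx
    have hx : 0 < x := by simpa using hx
    have : HasDerivAt (fun x => x * Real.cosh x - Real.sinh x)
        (1 * Real.cosh x + x * Real.sinh x - Real.cosh x) x :=
      ((hasDerivAt_id x).mul (Real.hasDerivAt_cosh x)).sub (Real.hasDerivAt_sinh x)
    rw [this.deriv]
    have := mul_nonneg hx.le (Real.sinh_nonneg_iff.2 hx.le)
    linarith
  have := hmono Set.self_mem_Ici (Set.mem_Ici.2 ha) ha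
  rw [Real.tanh_eq_sinh_div_cosh, div_le_iff₀ (Real.cosh_pos _)]
  simp at this
  linarith

end Response

section Recursion

variable {n : ℕ} (M : Matrix (Fin n) (Fin n) ℝ) (θ : Fin n → ℝ)

theorem eventWt_add_single (A : (Fin n → Bool) → Prop) (w : Fin n) (a : ℝ) :
    eventWt M (θ + Pi.single w a) A =
      Real.exp a * eventWt M θ (fun σ => A σ ∧ σ w = true) +
        Real.exp (-a) * eventWt M θ (fun σ => A σ ∧ σ w = false) := by
  rw [eventWt_split _ _ A w]
  unfold eventWt
  rw [Finset.mul_sum, Finset.mul_sum]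
  congr 1 <;>
  · refine Finset.sum_congr rfl fun σ hσ => ?_
    simp only [Finset.mem_filter, Finset.mem_univ, true_and] at hσ
    rw [isingWt_add_single, hσ.2]
    simp [spin]

theorem isingPr_add_single (A : (Fin n → Bool) → Prop) (w : Fin n) (a : ℝ) :
    isingPr M (θ + Pi.single w a) A =
      (Real.exp a * eventWt M θ (fun σ => A σ ∧ σ w = true) +
        Real.exp (-a) * eventWt M θ (fun σ => A σ ∧ σ w = false)) /
      (Real.exp a * eventWt M θ (fun σ => σ w = true) +
        Real.exp (-a) * eventWt M θ (fun σ => σ w = false)) := by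
  rw [isingPr_eq, eventWt_add_single, eventWt_add_single]
  simp only [true_and]

/-- Changing the field at `w` acts on the spin at `u` through the spin at `w`. -/
theorem isingPr_field_sub (u w : Fin n) (a : ℝ) :
    isingPr M (θ + Pi.single w a) (fun σ => σ u = true) -
        isingPr M (θ + Pi.single w (-a)) (fun σ => σ u = true) =
      fieldResponse (eventWt M θ (fun σ => σ w = true)) (eventWt M θ (fun σ => σ w = false)) a *
        influence M θ w u := by
  rw [isingPr_add_single, isingPr_add_single, influence, isingCond_eq, isingCond_eq, neg_neg,
    fieldResponse]
  have hA := eventWt_spin_pos M θ w true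
  have hB := eventWt_spin_pos M θ w false
  have hx := Real.exp_pos a
  have hy := Real.exp_pos (-a)
  generalize eventWt M θ (fun σ => σ w = true) = A at *
  generalize eventWt M θ (fun σ => σ w = false) = B at *
  generalize eventWt M θ (fun σ => σ u = true ∧ σ w = true) = A'
  generalize eventWt M θ (fun σ => σ u = true ∧ σ w = false) = B'
  generalize Real.exp a = x at *
  generalize Real.exp (-a) = y at *
  have h1 : x * A + y * B ≠ 0 := by positivity
  have h2 : y * A + x * B ≠ 0 := by positivity
  field_simp
  ring

/-- A spin with no interactions is independent of the others. -/
theorem eventWt_and_of_isolated (hsymm : ∀ i j, M i j = M j i) (v : Fin n)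
    (hv : ∀ j, M v j = 0) (hdiag : ∀ i, M i i = 0) (A : (Fin n → Bool) → Prop)
    (hA : ∀ σ s, A σ → A (Function.update σ v s)) (s : Bool) :
    eventWt M θ (fun σ => A σ ∧ σ v = s) =
      Real.exp (2 * (spin s * θ v)) * eventWt M θ (fun σ => A σ ∧ σ v = !s) := by
  have key : ∀ s, eventWt M θ (fun σ => A σ ∧ σ v = s) ≤
      Real.exp (2 * (spin s * θ v)) * eventWt M θ (fun σ => A σ ∧ σ v = !s) := by
    intro s
    refine eventWt_flip_le M θ _ v _ _ ?_ ?_ (Real.exp_pos _).le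
    · rintro σ ⟨h, rfl⟩
      exact ⟨hA σ _ h, by simp⟩
    · rintro σ ⟨h, rfl⟩
      rw [isingWt_flip M θ hsymm hdiag σ v]
      simp [hv]
  refine le_antisymm (key s) ?_
  have h := mul_le_mul_of_nonneg_left (key (!s)) (Real.exp_pos (2 * (spin s * θ v))).le
  rw [← mul_assoc (Real.exp _) (Real.exp _), ← Real.exp_add, spin_not, Bool.not_not] at h
  simpa using h

theorem isingCond_of_isolated (hsymm : ∀ i j, M i j = M j i) (v : Fin n)
    (hv : ∀ j, M v j = 0) (hdiag : ∀ i, M i i = 0) (A : (Fin n → Bool) → Prop)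
    (hA : ∀ σ s, A σ → A (Function.update σ v s)) (s : Bool) :
    isingCond M θ A (fun σ => σ v = s) = isingPr M θ A := by
  have h : ∀ B : (Fin n → Bool) → Prop, (∀ σ s, B σ → B (Function.update σ v s)) →
      eventWt M θ B =
        (1 + Real.exp (2 * (spin (!s) * θ v))) * eventWt M θ (fun σ => B σ ∧ σ v = s) := by
    intro B hB
    have h := eventWt_and_of_isolated M θ hsymm v hv hdiag B hB (!s)
    rw [Bool.not_not] at h
    rw [add_mul, one_mul, ← h, eventWt_split M θ B v]
    cases s <;> simp [add_comm]
  rw [isingCond_eq, isingPr_eq, h A hA, h (fun _ => True) fun _ _ _ => trivial]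
  simp only [true_and]
  rw [mul_div_mul_left]
  positivity

theorem isolate_symm (hsymm : ∀ i j, M i j = M j i) (v i j : Fin n) :
    isolate M v i j = isolate M v j i := by
  simp only [isolate, hsymm i j, or_comm]

theorem isolate_diag (hdiag : ∀ i, M i i = 0) (v i : Fin n) : isolate M v i i = 0 := by
  simp [isolate, hdiag]

/-- Conditioning on the spin at `v` turns its interactions into external fields. -/
theorem isingCond_eq_isolate (hsymm : ∀ i j, M i j = M j i) (hdiag : ∀ i, M i i = 0)
    (v : Fin n) (A : (Fin n → Bool) → Prop)
    (hA : ∀ σ s, A σ → A (Function.update σ v s)) (s : Bool) :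
    isingCond M θ A (fun σ => σ v = s) =
      isingPr (isolate M v) (fun i => θ i + spin s * M v i) A := by
  rw [← isingCond_of_isolated (isolate M v) _ (isolate_symm M hsymm v) v
    (fun j => by simp [isolate]) (isolate_diag M hdiag v) A hA s, isingCond_eq, isingCond_eq]
  have h : ∀ B : (Fin n → Bool) → Prop, (∀ σ, B σ → σ v = s) → eventWt M θ B =
      eventWt (isolate M v) (fun i => θ i + spin s * M v i) B := by
    intro B hB
    refine Finset.sum_congr rfl fun σ hσ => ?_
    rw [isingWt_isolate M θ hsymm hdiag σ v, hB σ (by simpa using hσ)]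
  rw [h _ fun σ hσ => hσ.2, h _ fun σ hσ => hσ]

/-- Telescoping over the coordinates of a perturbation. -/
theorem exists_telescope (F : (Fin n → ℝ) → ℝ) (m : Fin n → ℝ) :
    ∃ g : Fin n → Fin n → ℝ, (∀ w i, |g w i| ≤ |θ i| + |m i|) ∧
      F (fun i => θ i + m i) - F (fun i => θ i - m i) =
        ∑ w, (F (g w + Pi.single w (m w)) - F (g w + Pi.single w (-m w))) := by
  refine ⟨fun w i => θ i + if i < w then m i else if i = w then 0 else -m i, ?_, ?_⟩
  · intro w i
    refine (abs_add_le _ _).trans (add_le_add le_rfl ?_)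
    split_ifs <;> simp
  · set H : ℕ → Fin n → ℝ := fun k i => θ i + if i.val < k then m i else -m i with hH
    have h := Finset.sum_range_sub (fun k => F (H k)) n
    rw [← Fin.sum_univ_eq_sum_range (fun k => F (H (k + 1)) - F (H k)) n] at h
    have h0 : H 0 = fun i => θ i - m i := by
      funext i
      simp [hH, sub_eq_add_neg]
    have hn : H n = fun i => θ i + m i := by
      funext i
      simp [hH]
    rw [hn, h0] at h
    rw [← h]
    refine Finset.sum_congr rfl fun w _ => ?_
    congr 2
    · funext i
      rcases lt_trichotomy i w with hi | rfl | hi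
      · have : i.val < w.val + 1 := by omega
        simp [hH, hi, hi.ne, this]
      · simp [hH]
      · have : ¬ i.val < w.val + 1 := by omega
        simp [hH, hi.ne', hi.not_gt, this]
    · funext i
      rcases lt_trichotomy i w with hi | rfl | hi
      · have : i.val < w.val := by omega
        simp [hH, hi, hi.ne]
      · simp [hH]
      · simp [hH, hi.ne', hi.not_gt]

/-- The influence of `v` on `u` is a combination of the influences of the neighbours of `v`
after the deletion of `v`. -/
theorem exists_influence_recursion (hsymm : ∀ i j, M i j = M j i) (hdiag : ∀ i, M i i = 0)
    {v u : Fin n} (hvu : v ≠ u) :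
    ∃ g : Fin n → Fin n → ℝ, (∀ w i, |g w i| ≤ |θ i| + |M v i|) ∧
      influence M θ v u = ∑ w,
        fieldResponse (eventWt (isolate M v) (g w) (fun σ => σ w = true))
          (eventWt (isolate M v) (g w) (fun σ => σ w = false)) (M v w) *
        influence (isolate M v) (g w) w u := by
  obtain ⟨g, hg, h⟩ := exists_telescope θ
    (fun θ => isingPr (isolate M v) θ (fun σ => σ u = true)) (M v)
  refine ⟨g, hg, ?_⟩
  have hA : ∀ (σ : Fin n → Bool) (s : Bool), σ u = true → Function.update σ v s u = true := by
    intro σ s h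
    simpa [hvu.symm] using h
  rw [influence, isingCond_eq_isolate M θ hsymm hdiag v _ hA,
    isingCond_eq_isolate M θ hsymm hdiag v _ hA]
  simp only [isingPr_field_sub] at h
  rw [← h]
  simp [spin, sub_eq_add_neg]

theorem influence_self (v : Fin n) : influence M θ v v = 1 := by
  have h1 := eventWt_spin_pos M θ v true
  rw [influence, isingCond_eq, isingCond_eq]
  have h2 : eventWt M θ (fun σ => σ v = true ∧ σ v = false) = 0 := by
    refine Finset.sum_eq_zero fun σ hσ => ?_
    simp at hσ
  simp only [and_self, h2, div_self h1.ne']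
  simp

theorem abs_influence_le_one (v u : Fin n) : |influence M θ v u| ≤ 1 := by
  have h : ∀ s, 0 ≤ isingCond M θ (fun σ => σ u = true) (fun σ => σ v = s) ∧
      isingCond M θ (fun σ => σ u = true) (fun σ => σ v = s) ≤ 1 := by
    intro s
    have hs := eventWt_spin_pos M θ v s
    rw [isingCond_eq]
    exact ⟨div_nonneg (eventWt_nonneg _ _ _) hs.le,
      (div_le_one hs).2 (eventWt_mono M θ fun σ hσ => hσ.2)⟩
  rw [influence, abs_le]
  constructor <;> linarith [h true, h false, (h true).1, (h true).2, (h false).1, (h false).2]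

theorem eventWt_spin_le (hsymm : ∀ i j, M i j = M j i) (hdiag : ∀ i, M i i = 0) (w : Fin n)
    {h : ℝ} (hw : |θ w| + ∑ j, |M w j| ≤ h) (s : Bool) :
    eventWt M θ (fun σ => σ w = s) ≤ Real.exp (2 * h) * eventWt M θ (fun σ => σ w = !s) := by
  refine eventWt_flip_le M θ _ w _ _ ?_ ?_ (Real.exp_pos _).le
  · rintro σ rfl
    simp
  · rintro σ -
    rw [isingWt_flip M θ hsymm hdiag σ w]
    refine mul_le_mul_of_nonneg_right (Real.exp_le_exp.2 ?_) (isingWt_pos _ _ _).le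
    refine mul_le_mul_of_nonneg_left ((le_abs_self _).trans ?_) two_pos.le
    rw [abs_mul, abs_spin, one_mul]
    refine ((abs_add_le _ _).trans (add_le_add le_rfl ?_)).trans hw
    refine (Finset.abs_sum_le_sum_abs _ _).trans (Finset.sum_le_sum fun j _ => ?_)
    rw [abs_mul, abs_spin, mul_one]

end Recursion

section Paths

variable {n : ℕ} {M : Matrix (Fin n) (Fin n) ℝ} {v u w : Fin n}

theorem isolate_ne_zero {i j : Fin n} (h : isolate M v i j ≠ 0) :
    i ≠ v ∧ j ≠ v ∧ M i j ≠ 0 := by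
  unfold isolate at h
  split_ifs at h with h'
  · exact absurd rfl h
  · push Not at h'
    exact ⟨h'.1, h'.2, h⟩

theorem abs_isolate_le (i j : Fin n) : |isolate M v i j| ≤ |M i j| := by
  unfold isolate
  split_ifs
  · simp
  · exact le_rfl

theorem SparseInteraction.isolate {b : ℝ} {d : ℕ} (h : SparseInteraction M b d) (v : Fin n) :
    SparseInteraction (isolate M v) b d where
  symm := isolate_symm M h.symm v
  diag := isolate_diag M h.diag v
  bound i j := (abs_isolate_le i j).trans (h.bound i j)
  sparse i := by
    refine (Finset.card_le_card ?_).trans (h.sparse i)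
    intro j
    simpa using fun hj => (isolate_ne_zero hj).2.2

theorem girthGT_isolate {r : ℕ} (h : girthGT M r) (v : Fin n) : girthGT (isolate M v) r :=
  fun k p hk hp hadj => h k p hk hp fun i hi => (isolate_ne_zero (hadj i hi)).2.2

theorem IsPathOn.ne_of_isolate {p : ℕ → Fin n} {k : ℕ} (h : IsPathOn (isolate M v) p k w u)
    (hw : w ≠ v) : ∀ i ≤ k, p i ≠ v := by
  intro i hi
  rcases i with _ | i
  · rwa [h.source]
  · exact (isolate_ne_zero (h.adj i hi)).2.1

theorem IsPathOn.cons {p : ℕ → Fin n} {k : ℕ} (h : IsPathOn (isolate M v) p k w u)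
    (hvw : M v w ≠ 0) (hw : w ≠ v) :
    IsPathOn M (fun i => if i = 0 then v else p (i - 1)) (k + 1) v u where
  source := by simp
  target := by simp [h.target]
  adj i hi := by
    rcases i with _ | i
    · simpa [h.source] using hvw
    · simpa using (isolate_ne_zero (h.adj i (by omega))).2.2
  inj i hi j hj hij := by
    have hne := h.ne_of_isolate hw
    rcases i with _ | i <;> rcases j with _ | j
    · rfl
    · exact absurd hij.symm (by simpa using hne j (by omega))
    · exact absurd hij (by simpa using hne i (by omega))
    · rw [h.inj i (by omega) j (by omega) (by simpa using hij)]

theorem IsPathOn.tail {p : ℕ → Fin n} {k : ℕ} (h : IsPathOn M p (k + 1) v u) :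
    IsPathOn (isolate M v) (fun i => p (i + 1)) k (p 1) u where
  source := rfl
  target := h.target
  adj i hi := by
    have h1 : p (i + 1) ≠ v := fun h' =>
      absurd (h.inj (i + 1) (by omega) 0 (by omega) (h'.trans h.source.symm)) (by omega)
    have h2 : p (i + 1 + 1) ≠ v := fun h' =>
      absurd (h.inj (i + 1 + 1) (by omega) 0 (by omega) (h'.trans h.source.symm)) (by omega)
    simpa [_root_.isolate, h1, h2] using h.adj (i + 1) (by omega)
  inj i hi j hj hij := by
    have := h.inj (i + 1) (by omega) (j + 1) (by omega) hij
    omega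

/-- Two paths from `v` to `u` with different second vertices close up to a cycle. -/
theorem girth_lt_add_of_paths {r : ℕ} (hgirth : girthGT M r) (hsymm : ∀ i j, M i j = M j i)
    {p q : ℕ → Fin n} {k m : ℕ} (hp : IsPathOn M p k v u)
    (hq : IsPathOn (isolate M v) q m w u) (hvw : M v w ≠ 0) (hwv : w ≠ v) (hne : w ≠ p 1) :
    r < m + k + 1 := by
  have hqv := hq.ne_of_isolate hwv
  have hex : ∃ i, i ≤ m ∧ ∃ j ≤ k, q i = p j :=
    ⟨m, le_rfl, k, le_rfl, hq.target.trans hp.target.symm⟩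
  obtain ⟨him, J, hJk, hiJ⟩ := Nat.find_spec hex
  have hmin : ∀ s < Nat.find hex, ∀ j ≤ k, q s ≠ p j := fun s hs j hj h =>
    Nat.find_min hex hs ⟨by omega, j, hj, h⟩
  generalize Nat.find hex = i at *
  have hJ0 : J ≠ 0 := by
    rintro rfl
    exact hqv i him (hiJ.trans hp.source)
  have h2 : 2 < i + J + 1 := by
    by_contra hlt
    have hi : i = 0 := by omega
    have hJ : J = 1 := by omega
    subst hi hJ
    exact hne (hq.source.symm.trans hiJ)
  have := hgirth (i + J + 1)
    (fun t => if t ≤ i then q t else if t ≤ i + J then p (i + J - t) else q 0) h2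
    (by simp [show ¬ i + J + 1 ≤ i by omega]) ?_ ?_
  · omega
  · intro t ht
    rcases lt_trichotomy t i with h | rfl | h
    · have h1 : t + 1 ≤ i := h
      simpa [h.le, h1] using (isolate_ne_zero (hq.adj t (by omega))).2.2
    · have h1 : t + 1 ≤ t + J := by omega
      have e : J = t + J - (t + 1) + 1 := by omega
      have ha := hp.adj (t + J - (t + 1)) (by omega)
      rw [← e] at ha
      simpa [h1, hiJ, hsymm (p J)] using ha
    · have h1 : ¬ t ≤ i := by omega
      have h3 : ¬ t + 1 ≤ i := by omega
      by_cases h4 : t + 1 ≤ i + J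
      · have h5 : t ≤ i + J := by omega
        have e : i + J - t = i + J - (t + 1) + 1 := by omega
        have ha := hp.adj (i + J - (t + 1)) (by omega)
        rw [← e, hsymm] at ha
        simpa [h1, h3, h4, h5] using ha
      · have h5 : t = i + J := by omega
        subst h5
        simpa [h1, h3, hp.source, hq.source] using hvw
  · intro s hs t ht hst
    by_cases h1 : s ≤ i <;> by_cases h3 : t ≤ i
    · exact hq.inj s (by omega) t (by omega) (by simpa [h1, h3] using hst)
    · have h4 : t ≤ i + J := by omega
      simp only [h1, h3, h4, if_true, if_false] at hst
      rcases h1.lt_or_eq with h5 | rfl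
      · exact absurd hst (hmin s h5 _ (by omega))
      · have := hp.inj J hJk _ (by omega) (hiJ.symm.trans hst)
        omega
    · have h4 : s ≤ i + J := by omega
      simp only [h1, h3, h4, if_true, if_false] at hst
      rcases h3.lt_or_eq with h5 | rfl
      · exact absurd hst.symm (hmin t h5 _ (by omega))
      · have := hp.inj J hJk _ (by omega) (hiJ.symm.trans hst.symm)
        omega
    · have h4 : s ≤ i + J := by omega
      have h5 : t ≤ i + J := by omega
      simp only [h1, h3, h4, h5, if_true, if_false] at hst
      have := hp.inj _ (by omega) _ (by omega) hst
      omega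

end Paths

section Influence

variable {n : ℕ}

theorem abs_response_le (M : Matrix (Fin n) (Fin n) ℝ) (θ : Fin n → ℝ) (w : Fin n) (a : ℝ) :
    |fieldResponse (eventWt M θ (fun σ => σ w = true)) (eventWt M θ (fun σ => σ w = false)) a| ≤
      |a| := by
  refine (abs_fieldResponse_le a (eventWt_spin_pos M θ w true)
    (eventWt_spin_pos M θ w false)).trans ?_
  rw [abs_tanh]
  exact tanh_le_self (abs_nonneg a)

/-- Influences decay exponentially in the graph distance. -/
theorem abs_influence_le {b : ℝ} {d : ℕ} (hb : 0 ≤ b) (L : ℕ) :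
    ∀ (M : Matrix (Fin n) (Fin n) ℝ) (θ : Fin n → ℝ) (v u : Fin n), SparseInteraction M b d →
      (∀ p k, IsPathOn M p k v u → L ≤ k) → |influence M θ v u| ≤ (b * d) ^ L := by
  induction L with
  | zero =>
    intro M θ v u _ _
    simpa using abs_influence_le_one M θ v u
  | succ L ih =>
    intro M θ v u hM hL
    have hvu : v ≠ u := by
      rintro rfl
      have := hL (fun _ => v) 0 ⟨rfl, rfl, by simp, by intros; omega⟩
      omega
    obtain ⟨g, -, h⟩ := exists_influence_recursion M θ hM.symm hM.diag hvu
    rw [h]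
    refine (Finset.abs_sum_le_sum_abs _ _).trans ?_
    have hterm : ∀ w, |fieldResponse (eventWt (isolate M v) (g w) (fun σ => σ w = true))
          (eventWt (isolate M v) (g w) (fun σ => σ w = false)) (M v w) *
        influence (isolate M v) (g w) w u| ≤ if M v w ≠ 0 then b * (b * d) ^ L else 0 := by
      intro w
      split_ifs with hw
      · rw [abs_mul]
        refine mul_le_mul ((abs_response_le _ _ _ _).trans (hM.bound v w)) ?_ (abs_nonneg _) hb
        refine ih _ _ _ _ (hM.isolate v) fun p k hp => ?_
        have := hL _ _ (hp.cons hw (by rintro rfl; exact hw (hM.diag _)))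
        omega
      · push Not at hw
        simp [hw, fieldResponse_zero]
    refine (Finset.sum_le_sum fun w _ => hterm w).trans ?_
    rw [← Finset.sum_filter, Finset.sum_const, nsmul_eq_mul]
    calc _ ≤ (d : ℝ) * (b * (b * d) ^ L) :=
          mul_le_mul_of_nonneg_right (by exact_mod_cast hM.sparse v) (by positivity)
      _ = (b * d) ^ (L + 1) := by ring

/-- In a graph of large girth, the influence along a path of strong interactions dominates. -/
theorem le_abs_influence {b δ : ℝ} {d r : ℕ} (hb : 0 ≤ b) (hbd : b * d ≤ 1) (hδ : 0 ≤ δ) (N k : ℕ)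
    (hNk : N + k ≤ r) :
    ∀ (M : Matrix (Fin n) (Fin n) ℝ) (θ : Fin n → ℝ) (v u : Fin n) (p : ℕ → Fin n),
      SparseInteraction M b d → girthGT M r → (∀ i, |θ i| + ∑ j, |M i j| ≤ 2) →
      IsPathOn M p k v u → (∀ i < k, δ ≤ |M (p i) (p (i + 1))|) →
      (Real.exp (-4) * Real.tanh δ) ^ k - (b * d) ^ N ≤ |influence M θ v u| := by
  induction k with
  | zero =>
    intro M θ v u p _ _ _ hp _
    obtain rfl : v = u := hp.source.symm.trans hp.target
    have : 0 ≤ (b * d) ^ N := by positivity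
    simpa [influence_self] using this
  | succ k ih =>
    intro M θ v u p hM hgirth hθ hp hheavy
    have hvu : v ≠ u := by
      rintro rfl
      have := hp.inj 0 (by omega) (k + 1) le_rfl (hp.source.trans hp.target.symm)
      omega
    obtain ⟨g, hg, h⟩ := exists_influence_recursion M θ hM.symm hM.diag hvu
    have hadj : M v (p 1) ≠ 0 := by simpa [hp.source] using hp.adj 0 (by omega)
    have hfield : ∀ w i, |g w i| + ∑ j, |isolate M v i j| ≤ 2 := by
      intro w i
      refine le_trans ?_ (hθ i)
      have : |M v i| + ∑ j, |isolate M v i j| ≤ ∑ j, |M i j| := by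
        rw [← Finset.add_sum_erase _ _ (Finset.mem_univ v),
          ← Finset.add_sum_erase _ (fun j => |M i j|) (Finset.mem_univ v), hM.symm v i]
        have h0 : isolate M v i v = 0 := by simp [isolate]
        rw [h0, abs_zero, zero_add]
        exact add_le_add le_rfl (Finset.sum_le_sum fun j _ => abs_isolate_le i j)
      linarith [hg w i]
    set e : Fin n → ℝ := fun w =>
      fieldResponse (eventWt (isolate M v) (g w) (fun σ => σ w = true))
        (eventWt (isolate M v) (g w) (fun σ => σ w = false)) (M v w) with he
    have he_le : ∀ w, |e w| ≤ b := fun w => (abs_response_le _ _ _ _).trans (hM.bound v w)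
    have hδt : 0 ≤ Real.tanh δ := by simpa using tanh_monotone hδ
    have he_ge : Real.exp (-4) * Real.tanh δ ≤ |e (p 1)| := by
      have hs := fun s => eventWt_spin_le (isolate M v) (g (p 1)) (isolate_symm M hM.symm v)
        (isolate_diag M hM.diag v) (p 1) (hfield _ _) s
      refine le_trans ?_ (le_abs_fieldResponse (K := Real.exp (2 * 2)) (M v (p 1))
        (eventWt_spin_pos _ _ _ _) (eventWt_spin_pos _ _ _ _)
        (Real.one_le_exp (by norm_num)) (hs true) (hs false))
      rw [← Real.exp_neg, abs_tanh]
      norm_num only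
      refine mul_le_mul_of_nonneg_left (tanh_monotone ?_) (Real.exp_pos _).le
      simpa [hp.source] using hheavy 0 (by omega)
    have htail := ih (by omega) (isolate M v) (g (p 1)) (p 1) u (fun i => p (i + 1))
      (hM.isolate v) (girthGT_isolate hgirth v) (hfield _) hp.tail ?_
    swap
    · intro i hi
      have h1 : p (i + 1) ≠ v := fun h' =>
        absurd (hp.inj (i + 1) (by omega) 0 (by omega) (h'.trans hp.source.symm)) (by omega)
      have h2 : p (i + 1 + 1) ≠ v := fun h' =>
        absurd (hp.inj (i + 1 + 1) (by omega) 0 (by omega) (h'.trans hp.source.symm)) (by omega)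
      simpa [isolate, h1, h2] using hheavy (i + 1) (by omega)
    have hterm : ∀ w ∈ Finset.univ.erase (p 1), |e w * influence (isolate M v) (g w) w u| ≤
        if M v w ≠ 0 then b * (b * d) ^ N else 0 := by
      intro w hw
      split_ifs with hvw
      · rw [abs_mul]
        refine mul_le_mul (he_le w) ?_ (abs_nonneg _) hb
        refine abs_influence_le hb N _ _ _ _ (hM.isolate v) fun q m hq => ?_
        have := girth_lt_add_of_paths hgirth hM.symm hp hq hvw
          (by rintro rfl; exact hvw (hM.diag _)) (Finset.ne_of_mem_erase hw)
        omega
      · push Not at hvw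
        simp [he, hvw, fieldResponse_zero]
    have hrest : |∑ w ∈ Finset.univ.erase (p 1), e w * influence (isolate M v) (g w) w u| ≤
        (d - 1) * (b * (b * d) ^ N) := by
      refine (Finset.abs_sum_le_sum_abs _ _).trans ((Finset.sum_le_sum hterm).trans ?_)
      rw [← Finset.sum_filter, Finset.sum_const, nsmul_eq_mul]
      refine mul_le_mul_of_nonneg_right ?_ (by positivity)
      have hcard := hM.sparse v
      rw [Finset.filter_erase, Finset.card_erase_of_mem (by simpa using hadj)]
      have hpos : 0 < (Finset.univ.filter fun j => M v j ≠ 0).card :=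
        Finset.card_pos.2 ⟨p 1, by simpa using hadj⟩
      rw [Nat.cast_sub hpos]
      simpa using hcard
    rw [h, ← Finset.add_sum_erase _ _ (Finset.mem_univ (p 1))]
    have hmain : Real.exp (-4) * Real.tanh δ * (Real.exp (-4) * Real.tanh δ) ^ k - b * (b * d) ^ N ≤
        |e (p 1) * influence (isolate M v) (g (p 1)) (p 1) u| := by
      rw [abs_mul]
      have hc : 0 ≤ (Real.exp (-4) * Real.tanh δ) ^ k := by positivity
      have hE : 0 ≤ (b * d) ^ N := by positivity
      have t1 := mul_le_mul_of_nonneg_left htail (abs_nonneg (e (p 1)))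
      have t2 := mul_le_mul_of_nonneg_right he_ge hc
      have t3 := mul_le_mul_of_nonneg_right (he_le (p 1)) hE
      linarith
    have hfinal : (d - 1) * (b * (b * d) ^ N) + b * (b * d) ^ N ≤ (b * d) ^ N := by
      have hE : 0 ≤ (b * d) ^ N := by positivity
      calc _ = b * d * (b * d) ^ N := by ring
        _ ≤ _ := mul_le_of_le_one_left hE hbd
    have htri := abs_sub_abs_le_abs_add (e (p 1) * influence (isolate M v) (g (p 1)) (p 1) u)
      (∑ w ∈ Finset.univ.erase (p 1), e w * influence (isolate M v) (g w) w u)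
    rw [pow_succ']
    linarith

end Influence

/-- In a high-temperature Ising model whose graph has girth greater than `r`,
two vertices joined by a path of length `r' < r/2` all of whose edges have weight of absolute
value at least `δ` have correlation at least `e^{-4r'} tanh^{r'}(δ) - 2(bd)^{r/2}/(1-bd)`. -/
theorem stmt13 {n : ℕ} (b δ : ℝ) (d r : ℕ) (hδ : 0 < δ) (hδb : δ ≤ b)
    (hd : 0 < d) (hr : 0 < r) (hn : 0 < n) (hbd : b * d < 1)
    (θ : Fin n → ℝ) (hθ : ∀ i, |θ i| ≤ b)
    (M : Matrix (Fin n) (Fin n) ℝ)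
    (hsymm : M.IsSymm) (hdiag : ∀ i, M i i = 0)
    (hbound : ∀ i j, |M i j| ≤ b)
    (hsparse : ∀ i, (Finset.univ.filter (fun j => M i j ≠ 0)).card ≤ d)
    (hgirth : girthGT M r)
    (v u : Fin n) (hvu : v ≠ u)
    (r' : ℕ) (hr' : (r' : ℝ) < r / 2)
    (hpath : heavyPathOfLength M δ r' v u) :
    Real.exp (-4 * r') * Real.tanh δ ^ r' - 2 * (b * d) ^ ((r : ℝ) / 2) / (1 - b * d)
      ≤ |isingCond M θ (fun σ => σ v = true) (fun σ => σ u = true) -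
          isingCond M θ (fun σ => σ v = true) (fun σ => σ u = false)| := by
  have hb : 0 < b := hδ.trans_le hδb
  have hd1 : (1 : ℝ) ≤ d := by exact_mod_cast hd
  obtain ⟨p, hp0, hpr, hadj, hinj⟩ := hpath
  have hS : ∀ i j, M i j = M j i := fun i j => hsymm.apply j i
  have hM : SparseInteraction M b d := ⟨hS, hdiag, hbound, hsparse⟩
  have hrN : 2 * r' < r := by
    have : (2 * r' : ℝ) < r := by linarith
    exact_mod_cast this
  have hfield : ∀ i, |θ i| + ∑ j, |M i j| ≤ 2 := by
    intro i
    have h1 : ∑ j, |M i j| ≤ d * b := by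
      calc _ ≤ ∑ j, if M i j ≠ 0 then b else 0 := by
            refine Finset.sum_le_sum fun j _ => ?_
            split_ifs with h
            · exact hbound i j
            · simp [not_not.1 h]
        _ ≤ _ := by
            rw [← Finset.sum_filter, Finset.sum_const, nsmul_eq_mul]
            exact mul_le_mul_of_nonneg_right (by exact_mod_cast hsparse i) hb.le
    nlinarith [hθ i]
  have hrev : IsPathOn M (fun i => p (r' - i)) r' u v :=
    { source := by simpa using hpr
      target := by simpa using hp0
      adj := fun i hi => by
        have h := (hadj (r' - (i + 1)) (by omega)).1
        rwa [show r' - (i + 1) + 1 = r' - i by omega, hS] at h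
      inj := fun i hi j hj hij => by
        have := hinj _ (by omega) _ (by omega) hij
        omega }
  have key := le_abs_influence hb.le hbd.le hδ.le (r - r') r' (by omega) M θ u v _ hM hgirth hfield
    hrev fun i hi => by
      have h := (hadj (r' - (i + 1)) (by omega)).2
      rwa [show r' - (i + 1) + 1 = r' - i by omega, hS] at h
  have hbd0 : 0 < b * d := by positivity
  have herr : (b * d) ^ (r - r') ≤ 2 * (b * d) ^ ((r : ℝ) / 2) / (1 - b * d) := by
    have h1 : (b * d) ^ (r - r') ≤ (b * d) ^ ((r : ℝ) / 2) := by
      rw [← Real.rpow_natCast]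
      refine Real.rpow_le_rpow_of_exponent_ge hbd0 hbd.le ?_
      rw [Nat.cast_sub (by omega)]
      linarith
    have h2 : 0 < (b * d) ^ ((r : ℝ) / 2) := Real.rpow_pos_of_pos hbd0 _
    rw [le_div_iff₀ (by linarith)]
    have h3 : 0 ≤ (b * d) ^ (r - r') := by positivity
    nlinarith
  rw [mul_pow, ← Real.exp_nat_mul, mul_comm (r' : ℝ)] at key
  rw [influence] at key
  linarith
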